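/- Let ρ_AB be a density operator on H_A ⊗ H_B and let α, β, γ ≠ 1 satisfy α/(α−1) = β/(β−1) + γ/(γ−1). If α ∈ (1,2) and β, γ ∈ (1,∞), then I↑_γ(A;B)_ρ ≥ H_β(B)_ρ − H↓_α(B|A)_ρ and I↓_γ(A:B)_ρ ≥ H_β(B)_ρ − H↑_α(B|A)_ρ. If α ∈ [2/3,1) and β, γ ∈ [1/2,1), then I↑_γ(A;B)_ρ ≤ H_β(B)_ρ − H↓_α(B|A)_ρ and I↓_γ(A:B)_ρ ≤ H_β(B)_ρ − H↑_α(B|A)_ρ. -/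

import Mathlib

open scoped Kronecker ComplexOrder Classical
open Matrix

noncomputable section

/-- Real power taken on the support: `0 ^ r = 0` for every `r`. -/
def supPow (x r : ℝ) : ℝ := if x = 0 then 0 else x ^ r

variable {n : Type*} [Fintype n] [DecidableEq n]

/-- Power of a Hermitian matrix, taken on its support (junk value `0` otherwise). -/
def matPow (M : Matrix n n ℂ) (r : ℝ) : Matrix n n ℂ :=
  if hM : M.IsHermitian then
    (hM.eigenvectorUnitary : Matrix n n ℂ) *
      (Matrix.diagonal fun i => (supPow (hM.eigenvalues i) r : ℂ)) *
      (star (hM.eigenvectorUnitary : Matrix n n ℂ))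
  else 0

/-- A density operator: positive semidefinite with unit trace. -/
def IsDensity (ρ : Matrix n n ℂ) : Prop := ρ.PosSemidef ∧ ρ.trace = 1

/-- `σ` dominates `ρ`: the kernel of `σ` is contained in the kernel of `ρ`
(equivalently, `supp ρ ⊆ supp σ` for positive semidefinite matrices). -/
def Dominates (σ ρ : Matrix n n ℂ) : Prop := ∀ v, σ.mulVec v = 0 → ρ.mulVec v = 0

/-- The sandwiched Rényi divergence of order `α` (base-2 logarithm), with value `⊤`
when `ρ ⟂ σ`, or when `α > 1` and `supp ρ ⊄ supp σ`. -/
def renyiDiv (α : ℝ) (ρ σ : Matrix n n ℂ) : EReal :=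
  if (ρ * σ).trace ≠ 0 ∧ (Dominates σ ρ ∨ α < 1) then
    (((α - 1)⁻¹ * Real.logb 2
      ((matPow (matPow σ ((1 - α) / (2 * α)) * ρ * matPow σ ((1 - α) / (2 * α))) α).trace.re) : ℝ)
      : EReal)
  else ⊤

/-- The Rényi entropy of order `α` (base-2 logarithm). -/
def renyiEntropy (α : ℝ) (ρ : Matrix n n ℂ) : ℝ :=
  (1 - α)⁻¹ * Real.logb 2 ((matPow ρ α).trace.re)

variable {A B : Type*} [Fintype A] [Fintype B] [DecidableEq A] [DecidableEq B]

/-- Marginal on the first factor: `ρ_A = tr_B ρ_AB`. -/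
def margFst (ρ : Matrix (A × B) (A × B) ℂ) : Matrix A A ℂ :=
  Matrix.of fun a a' => ∑ b, ρ (a, b) (a', b)

/-- Marginal on the second factor: `ρ_B = tr_A ρ_AB`. -/
def margSnd (ρ : Matrix (A × B) (A × B) ℂ) : Matrix B B ℂ :=
  Matrix.of fun b b' => ∑ a, ρ (a, b) (a, b')

/-- `H↓_α(B|A)_ρ = −D_α(ρ_AB ‖ ρ_A ⊗ 1_B)`. -/
def condEntDown (α : ℝ) (ρ : Matrix (A × B) (A × B) ℂ) : EReal :=
  - renyiDiv α ρ (margFst ρ ⊗ₖ (1 : Matrix B B ℂ))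

/-- `H↑_α(B|A)_ρ = sup_{σ_A} −D_α(ρ_AB ‖ σ_A ⊗ 1_B)`. -/
def condEntUp (α : ℝ) (ρ : Matrix (A × B) (A × B) ℂ) : EReal :=
  ⨆ σA : {σ : Matrix A A ℂ // IsDensity σ},
    - renyiDiv α ρ ((σA : Matrix A A ℂ) ⊗ₖ (1 : Matrix B B ℂ))

/-- `I↑_γ(A;B)_ρ = inf_{σ_B} D_γ(ρ_AB ‖ ρ_A ⊗ σ_B)`. -/
def mutInfUp (γ : ℝ) (ρ : Matrix (A × B) (A × B) ℂ) : EReal :=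
  ⨅ σB : {σ : Matrix B B ℂ // IsDensity σ},
    renyiDiv γ ρ (margFst ρ ⊗ₖ (σB : Matrix B B ℂ))

/-- `I↓_γ(A:B)_ρ = inf_{σ_A, σ_B} D_γ(ρ_AB ‖ σ_A ⊗ σ_B)`. -/
def mutInfDown (γ : ℝ) (ρ : Matrix (A × B) (A × B) ℂ) : EReal :=
  ⨅ σA : {σ : Matrix A A ℂ // IsDensity σ}, ⨅ σB : {σ : Matrix B B ℂ // IsDensity σ},
    renyiDiv γ ρ ((σA : Matrix A A ℂ) ⊗ₖ (σB : Matrix B B ℂ))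

end


section PowerCalculus

variable {n m : Type*} [Fintype n] [DecidableEq n] [Fintype m] [DecidableEq m]

/-- Complex power of a real number taken on the support. -/
noncomputable def supCPow (x : ℝ) (z : ℂ) : ℂ := if x = 0 then 0 else (x : ℂ) ^ z

/-- Complex power of a Hermitian matrix taken on its support. -/
noncomputable def matCPow (M : Matrix n n ℂ) (z : ℂ) : Matrix n n ℂ :=
  if hM : M.IsHermitian then
    (hM.eigenvectorUnitary : Matrix n n ℂ) *
      (Matrix.diagonal fun i => supCPow (hM.eigenvalues i) z) *
      (star (hM.eigenvectorUnitary : Matrix n n ℂ))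
  else 0

lemma supCPow_add (x : ℝ) (z w : ℂ) : supCPow x (z + w) = supCPow x z * supCPow x w := by
  unfold supCPow
  split_ifs with h
  · simp
  · exact Complex.cpow_add _ _ (by exact_mod_cast h)

lemma supCPow_ofReal {x : ℝ} (hx : 0 ≤ x) (r : ℝ) : supCPow x r = (supPow x r : ℂ) := by
  unfold supCPow supPow
  split_ifs with h
  · simp
  · rw [Complex.ofReal_cpow hx]

lemma star_supCPow {x : ℝ} (hx : 0 ≤ x) (z : ℂ) : star (supCPow x z) = supCPow x (star z) := by
  unfold supCPow
  split_ifs with h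
  · simp
  · have := Complex.conj_cpow (x : ℂ) z (by
      rw [Complex.arg_ofReal_of_nonneg hx]; exact Real.pi_pos.ne)
    simp only [RCLike.star_def]
    rw [Complex.cpow_conj _ _ (by
      rw [Complex.arg_ofReal_of_nonneg hx]; exact Real.pi_pos.ne)]
    simp

lemma supCPow_mul {x y : ℝ} (hx : 0 ≤ x) (hy : 0 ≤ y) (z : ℂ) :
    supCPow (x * y) z = supCPow x z * supCPow y z := by
  unfold supCPow
  by_cases h : x = 0
  · simp [h]
  by_cases h' : y = 0
  · simp [h']
  simp only [h, h', mul_eq_zero, or_self, if_false, Complex.ofReal_mul]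
  exact Complex.mul_cpow_ofReal_nonneg hx hy z

lemma supPow_nonneg {x : ℝ} (hx : 0 ≤ x) (r : ℝ) : 0 ≤ supPow x r := by
  unfold supPow
  split_ifs
  exacts [le_rfl, Real.rpow_nonneg hx _]

lemma supPow_pos {x : ℝ} (hx : 0 < x) (r : ℝ) : 0 < supPow x r := by
  rw [supPow, if_neg hx.ne']
  exact Real.rpow_pos_of_pos hx _

lemma supPow_mul_le {x : ℝ} (hx : 0 ≤ x) (r s : ℝ) : supPow x (r * s) ≤ supPow x r ^ s := by
  unfold supPow
  split_ifs
  · positivity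
  · rw [Real.rpow_mul hx]

lemma supCPow_supPow {x : ℝ} (hx : 0 ≤ x) (r : ℝ) (z : ℂ) :
    supCPow (supPow x r) z = supCPow x (r * z) := by
  rcases hx.eq_or_lt with rfl | h
  · simp [supCPow, supPow]
  · have h2 := supPow_pos h r
    rw [supCPow, if_neg h2.ne', supCPow, if_neg h.ne', supPow, if_neg h.ne']
    rw [Complex.cpow_def_of_ne_zero (by exact_mod_cast (Real.rpow_pos_of_pos h r).ne'),
      Complex.cpow_def_of_ne_zero (by exact_mod_cast h.ne'), ← Complex.ofReal_log (by positivity),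
      Real.log_rpow h, ← Complex.ofReal_log hx]
    push_cast
    ring_nf

lemma exists_phase {x : ℝ} (hx : 0 ≤ x) (z : ℂ) :
    ∃ u : ℂ, star u * u = 1 ∧ supCPow x z = u * supCPow x z.re := by
  rcases hx.eq_or_lt with rfl | h
  · exact ⟨1, by simp, by simp [supCPow]⟩
  · refine ⟨(x : ℂ) ^ (z.im * Complex.I), ?_, ?_⟩
    · have : ‖(x : ℂ) ^ (z.im * Complex.I)‖ = 1 := by
        rw [Complex.norm_cpow_eq_rpow_re_of_pos h]; simp
      rw [RCLike.star_def, Complex.conj_mul', this]; simp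
    · rw [supCPow, if_neg h.ne', supCPow, if_neg h.ne',
        ← Complex.cpow_add _ _ (by exact_mod_cast h.ne')]
      congr 1
      rw [add_comm]
      exact (Complex.re_add_im z).symm

/-- Any unitary diagonalization computes the complex power. -/
lemma matCPow_eq {M V : Matrix n n ℂ} {d : n → ℝ} (hV : star V * V = 1)
    (hM : M = V * diagonal (fun i => (d i : ℂ)) * star V) (z : ℂ) :
    matCPow M z = V * diagonal (fun i => supCPow (d i) z) * star V := by
  have hH : M.IsHermitian := by
    rw [hM, star_eq_conjTranspose, Matrix.IsHermitian]
    simp only [conjTranspose_mul, conjTranspose_conjTranspose, diagonal_conjTranspose, mul_assoc]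
    congr 3
    ext i
    simp
  have hV' : V * star V = 1 := mul_eq_one_comm.mp hV
  rw [matCPow, dif_pos hH]
  have hspec := hH.spectral_theorem
  rw [Unitary.conjStarAlgAut_apply] at hspec
  set U : Matrix n n ℂ := hH.eigenvectorUnitary.1 with hU
  have hUU : star U * U = 1 := by simp [hU]
  have hUU' : U * star U = 1 := mul_eq_one_comm.mp hUU
  have key : diagonal (fun i => (hH.eigenvalues i : ℂ)) * (star U * V) =
      (star U * V) * diagonal (fun i => (d i : ℂ)) := by
    have h1 : star U * M * V = diagonal (fun i => (hH.eigenvalues i : ℂ)) * (star U * V) := by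
      conv_lhs => rw [hspec]
      simp only [mul_assoc]
      rw [← mul_assoc (star U) U, hUU, one_mul]
      rfl
    have h2 : star U * M * V = (star U * V) * diagonal (fun i => (d i : ℂ)) := by
      rw [hM]
      simp only [mul_assoc]
      rw [hV, mul_one]
    rw [← h1, h2]
  have key2 : diagonal (fun i => supCPow (hH.eigenvalues i) z) * (star U * V) =
      (star U * V) * diagonal (fun i => supCPow (d i) z) := by
    ext i j
    have := congrFun (congrFun key i) j
    rw [diagonal_mul, mul_diagonal] at this ⊢
    by_cases h0 : (star U * V) i j = 0
    · simp [h0]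
    · rw [mul_comm] at this
      have := mul_left_cancel₀ h0 this
      have : hH.eigenvalues i = d j := by exact_mod_cast this
      rw [this, mul_comm]
  calc U * diagonal (fun i => supCPow (hH.eigenvalues i) z) * star U
      = U * (diagonal (fun i => supCPow (hH.eigenvalues i) z) * (star U * V)) * star V := by
        simp only [mul_assoc]; rw [hV', mul_one]
    _ = _ := by
        rw [key2]; simp only [← mul_assoc]; rw [hUU', one_mul]

/-- A positive semidefinite matrix has a unitary diagonalization with nonnegative eigenvalues. -/
lemma exists_diag {M : Matrix n n ℂ} (hM : M.PosSemidef) :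
    ∃ (V : Matrix n n ℂ) (d : n → ℝ), star V * V = 1 ∧ V * star V = 1 ∧ (∀ i, 0 ≤ d i) ∧
      M = V * diagonal (fun i => (d i : ℂ)) * star V ∧
      (∀ z, matCPow M z = V * diagonal (fun i => supCPow (d i) z) * star V) ∧
      ∀ r, matPow M r = V * diagonal (fun i => (supPow (d i) r : ℂ)) * star V := by
  have hspec := hM.1.spectral_theorem
  rw [Unitary.conjStarAlgAut_apply] at hspec
  refine ⟨(hM.1.eigenvectorUnitary : Matrix n n ℂ), hM.1.eigenvalues, by simp, by simp,
    hM.eigenvalues_nonneg,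
    hspec, fun z => ?_, fun r => ?_⟩
  · rw [matCPow, dif_pos hM.1]
  · rw [matPow, dif_pos hM.1]

lemma matPow_eq_matCPow {M : Matrix n n ℂ} (hM : M.PosSemidef) (r : ℝ) :
    matPow M r = matCPow M r := by
  obtain ⟨V, d, hV, hV', hd, h1, h2, h3⟩ := exists_diag hM
  rw [h2, h3]
  simp only [supCPow_ofReal (hd _)]

lemma matCPow_one {M : Matrix n n ℂ} (hM : M.PosSemidef) : matCPow M 1 = M := by
  obtain ⟨V, d, hV, hV', hd, h1, h2, h3⟩ := exists_diag hM
  rw [h2, h1]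
  congr! 4 with i
  by_cases h : d i = 0 <;> simp [supCPow, h]

lemma matCPow_add {M : Matrix n n ℂ} (hM : M.PosSemidef) (z w : ℂ) :
    matCPow M (z + w) = matCPow M z * matCPow M w := by
  obtain ⟨V, d, hV, hV', hd, h1, h2, h3⟩ := exists_diag hM
  simp only [h2, mul_assoc]
  rw [← mul_assoc (star V) V, hV, one_mul, ← mul_assoc (diagonal _) (diagonal _),
    diagonal_mul_diagonal]
  simp only [supCPow_add]

lemma matCPow_conjTranspose {M : Matrix n n ℂ} (hM : M.PosSemidef) (z : ℂ) :
    (matCPow M z)ᴴ = matCPow M (star z) := by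
  obtain ⟨V, d, hV, hV', hd, h1, h2, h3⟩ := exists_diag hM
  simp only [h2, star_eq_conjTranspose, conjTranspose_mul, conjTranspose_conjTranspose,
    diagonal_conjTranspose, mul_assoc]
  congr! 3 with i
  funext i
  exact star_supCPow (hd i) z

lemma matCPow_ofReal_isHermitian {M : Matrix n n ℂ} (hM : M.PosSemidef) (r : ℝ) :
    (matCPow M r)ᴴ = matCPow M r := by
  rw [matCPow_conjTranspose hM]; simp

lemma matCPow_posSemidef {M : Matrix n n ℂ} (hM : M.PosSemidef) (r : ℝ) :
    (matCPow M r).PosSemidef := by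
  have : (r : ℂ) = ((r / 2 : ℝ) : ℂ) + ((r / 2 : ℝ) : ℂ) := by push_cast; ring
  rw [this, matCPow_add hM]
  nth_rewrite 1 [← matCPow_ofReal_isHermitian hM]
  exact posSemidef_conjTranspose_mul_self _

lemma matCPow_matCPow {M : Matrix n n ℂ} (hM : M.PosSemidef) (r : ℝ) (z : ℂ) :
    matCPow (matCPow M r) z = matCPow M (r * z) := by
  obtain ⟨V, d, hV, hV', hd, h1, h2, h3⟩ := exists_diag hM
  rw [← matPow_eq_matCPow hM, matCPow_eq hV (h3 r), h2]
  simp only [supCPow_supPow (hd _)]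

lemma matCPow_unitary_conj {M T : Matrix n n ℂ} (hM : M.PosSemidef) (hT : star T * T = 1)
    (z : ℂ) : matCPow (T * M * star T) z = T * matCPow M z * star T := by
  obtain ⟨V, d, hV, hV', hd, h1, h2, h3⟩ := exists_diag hM
  rw [matCPow_eq (V := T * V) (d := d), h2]
  · simp only [star_mul, mul_assoc]
  · rw [star_mul, mul_assoc, ← mul_assoc (star T), hT, one_mul, hV]
  · rw [h1]; simp only [star_mul, mul_assoc]

lemma matCPow_kronecker {M : Matrix n n ℂ} {N : Matrix m m ℂ} (hM : M.PosSemidef)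
    (hN : N.PosSemidef) (z : ℂ) : matCPow (M ⊗ₖ N) z = matCPow M z ⊗ₖ matCPow N z := by
  obtain ⟨V, d, hV, hV', hd, h1, h2, h3⟩ := exists_diag hM
  obtain ⟨W, e, hW, hW', he, k1, k2, k3⟩ := exists_diag hN
  rw [matCPow_eq (V := V ⊗ₖ W) (d := fun i => d i.1 * e i.2), h2, k2]
  · rw [mul_kronecker_mul, mul_kronecker_mul, diagonal_kronecker_diagonal,
      star_eq_conjTranspose (V ⊗ₖ W), conjTranspose_kronecker]
    simp only [supCPow_mul (hd _) (he _)]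
    rfl
  · rw [star_eq_conjTranspose, conjTranspose_kronecker, ← mul_kronecker_mul]
    simp only [star_eq_conjTranspose] at hV hW
    rw [hV, hW, one_kronecker_one]
  · conv_lhs => rw [h1, k1]
    rw [mul_kronecker_mul, mul_kronecker_mul, diagonal_kronecker_diagonal,
      star_eq_conjTranspose (V ⊗ₖ W), conjTranspose_kronecker]
    simp only [Complex.ofReal_mul]
    rfl

lemma matCPow_one_left (z : ℂ) : matCPow (1 : Matrix n n ℂ) z = 1 := by
  rw [matCPow_eq (V := 1) (d := fun _ => 1)] <;> simp [supCPow]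

lemma matCPow_smul {M : Matrix n n ℂ} (hM : M.PosSemidef) {c : ℝ} (hc : 0 < c) (z : ℂ) :
    matCPow ((c : ℂ) • M) z = ((c : ℂ) ^ z) • matCPow M z := by
  obtain ⟨V, d, hV, hV', hd, h1, h2, h3⟩ := exists_diag hM
  rw [matCPow_eq (d := fun i => c * d i) hV, h2]
  · simp only [supCPow_mul hc.le (hd _)]
    rw [← Matrix.smul_mul, ← Matrix.mul_smul, ← diagonal_smul]
    congr! 4 with i
    simp [supCPow, hc.ne']
  · rw [h1, ← Matrix.smul_mul, ← Matrix.mul_smul, ← diagonal_smul]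
    congr! 4 with i
    simp

lemma exists_unitary_matCPow {M : Matrix n n ℂ} (hM : M.PosSemidef) (z : ℂ) :
    ∃ T : Matrix n n ℂ, star T * T = 1 ∧ matCPow M z = T * matCPow M z.re := by
  obtain ⟨V, d, hV, hV', hd, h1, h2, h3⟩ := exists_diag hM
  choose u hu hu' using fun i => exists_phase (hd i) z
  refine ⟨V * diagonal u * star V, ?_, ?_⟩
  · have : diagonal (star u) * diagonal u = 1 := by
      rw [diagonal_mul_diagonal, ← diagonal_one]
      congr 1; funext i; exact hu i
    simp only [star_eq_conjTranspose, conjTranspose_mul, conjTranspose_conjTranspose,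
      diagonal_conjTranspose, mul_assoc] at hV hV' ⊢
    rw [← mul_assoc Vᴴ V, hV, one_mul, ← mul_assoc (diagonal _) (diagonal _), this, one_mul, hV']
  · simp only [h2, mul_assoc]
    rw [← mul_assoc (star V) V, hV, one_mul, ← mul_assoc (diagonal _) (diagonal _),
      diagonal_mul_diagonal]
    congr! 4 with i
    exact hu' i

lemma matCPow_zero_mul_of_eq {Q F : Matrix n n ℂ} (hQ : F * Fᴴ = Q) : matCPow Q 0 * F = F := by
  have hP : Q.PosSemidef := hQ ▸ posSemidef_self_mul_conjTranspose F
  have h0 : (matCPow Q 0)ᴴ = matCPow Q 0 := by simpa using matCPow_ofReal_isHermitian hP 0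
  have h1 : matCPow Q 0 * Q = Q := by
    have := matCPow_add hP 0 1
    rwa [zero_add, matCPow_one hP, eq_comm] at this
  have h2 : (matCPow Q 0 * F - F) * (matCPow Q 0 * F - F)ᴴ = 0 := by
    rw [conjTranspose_sub, conjTranspose_mul, h0]
    calc _ = matCPow Q 0 * (F * Fᴴ) * matCPow Q 0 - matCPow Q 0 * (F * Fᴴ)
          - (F * Fᴴ) * matCPow Q 0 + F * Fᴴ := by noncomm_ring
      _ = 0 := by rw [hQ, h1]; simp
  exact sub_eq_zero.mp (self_mul_conjTranspose_eq_zero.mp h2)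

lemma trace_matPow_nonneg {M : Matrix n n ℂ} (hM : M.PosSemidef) (r : ℝ) :
    0 ≤ (matPow M r).trace.re := by
  rw [matPow_eq_matCPow hM]
  exact (Complex.le_def.mp (matCPow_posSemidef hM r).trace_nonneg).1

lemma trace_matPow_pos {M : Matrix n n ℂ} (hM : M.PosSemidef) (h0 : M ≠ 0) (r : ℝ) :
    0 < (matPow M r).trace.re := by
  obtain ⟨V, d, hV, hV', hd, h1, h2, h3⟩ := exists_diag hM
  rw [h3, mul_assoc, trace_mul_comm, mul_assoc, hV, mul_one, trace_diagonal, Complex.re_sum]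
  simp only [Complex.ofReal_re]
  have : ∃ i, d i ≠ 0 := by
    by_contra! h
    apply h0
    rw [h1]
    simp [h]
  obtain ⟨i, hi⟩ := this
  exact Finset.sum_pos' (fun j _ => supPow_nonneg (hd j) r)
    ⟨i, Finset.mem_univ _, supPow_pos ((hd i).lt_of_ne' hi) r⟩

end PowerCalculus

section Holder

variable {n : Type*} [Fintype n] [DecidableEq n]

/-- Both `C` and its adjoint are contractions. -/
def IsContr (C : Matrix n n ℂ) : Prop :=
  (1 - Cᴴ * C).PosSemidef ∧ (1 - C * Cᴴ).PosSemidef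

lemma IsContr.conjTranspose {C : Matrix n n ℂ} (h : IsContr C) : IsContr Cᴴ := by
  refine ⟨?_, ?_⟩
  · simpa using h.2
  · simpa using h.1

lemma IsContr.mul {C D : Matrix n n ℂ} (hC : IsContr C) (hD : IsContr D) :
    IsContr (C * D) := by
  refine ⟨?_, ?_⟩
  · have : 1 - (C * D)ᴴ * (C * D) = Dᴴ * (1 - Cᴴ * C) * D + (1 - Dᴴ * D) := by
      rw [conjTranspose_mul]; noncomm_ring
    rw [this]
    exact (hC.1.conjTranspose_mul_mul_same D).add hD.1
  · have : 1 - (C * D) * (C * D)ᴴ = C * (1 - D * Dᴴ) * Cᴴ + (1 - C * Cᴴ) := by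
      rw [conjTranspose_mul]; noncomm_ring
    rw [this]
    exact (hD.2.mul_mul_conjTranspose_same C).add hC.2

lemma isContr_of_unitary {V : Matrix n n ℂ} (hV : star V * V = 1) : IsContr V := by
  have hV' : V * star V = 1 := mul_eq_one_comm.mp hV
  rw [star_eq_conjTranspose] at hV hV'
  constructor <;> simp [hV, hV', PosSemidef.zero]

lemma posSemidef_one_sub_of_idempotent {P : Matrix n n ℂ} (h : Pᴴ = P) (h2 : P * P = P) :
    (1 - P).PosSemidef := by
  have : 1 - P = (1 - P)ᴴ * (1 - P) := by
    rw [conjTranspose_sub, conjTranspose_one, h]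
    simp [mul_sub, sub_mul, h2]
  rw [this]
  exact posSemidef_conjTranspose_mul_self _

/-- The polar part of `F`, up to a phase, is a contraction. -/
lemma isContr_polar {Q F : Matrix n n ℂ} (hQ : F * Fᴴ = Q) {z : ℂ} (hz : z.re = -1 / 2) :
    IsContr (matCPow Q z * F) := by
  have hP : Q.PosSemidef := hQ ▸ posSemidef_self_mul_conjTranspose F
  have hzz : z + star z = -1 := by
    apply Complex.ext <;> simp [hz]
  have e1 : (matCPow Q z * F) * (matCPow Q z * F)ᴴ = matCPow Q 0 := by
    rw [conjTranspose_mul, matCPow_conjTranspose hP]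
    calc _ = matCPow Q z * (F * Fᴴ) * matCPow Q (star z) := by simp only [mul_assoc]
      _ = matCPow Q z * matCPow Q 1 * matCPow Q (star z) := by rw [hQ, matCPow_one hP]
      _ = matCPow Q (z + 1 + star z) := by rw [matCPow_add hP, matCPow_add hP]
      _ = _ := by congr 1; linear_combination hzz
  have e2 : (matCPow Q z * F)ᴴ * (matCPow Q z * F) = Fᴴ * matCPow Q (-1) * F := by
    rw [conjTranspose_mul, matCPow_conjTranspose hP]
    calc _ = Fᴴ * (matCPow Q (star z) * matCPow Q z) * F := by simp only [mul_assoc]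
      _ = _ := by rw [← matCPow_add hP, add_comm, hzz]
  have hH (r : ℝ) := matCPow_ofReal_isHermitian hP r
  refine ⟨?_, ?_⟩
  · rw [e2]
    apply posSemidef_one_sub_of_idempotent
    · have := hH (-1)
      push_cast at this
      simp only [conjTranspose_mul, conjTranspose_conjTranspose, this, mul_assoc]
    · calc _ = Fᴴ * matCPow Q (-1) * (F * Fᴴ) * matCPow Q (-1) * F := by simp only [mul_assoc]
        _ = Fᴴ * (matCPow Q (-1) * matCPow Q 1 * matCPow Q (-1)) * F := by
          rw [hQ, matCPow_one hP]; simp only [mul_assoc]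
        _ = _ := by rw [← matCPow_add hP, ← matCPow_add hP]; norm_num
  · rw [e1]
    apply posSemidef_one_sub_of_idempotent
    · simpa using hH 0
    · rw [← matCPow_add hP, add_zero]

lemma IsContr.col_le {C : Matrix n n ℂ} (h : IsContr C) (j : n) : ∑ i, ‖C i j‖ ^ 2 ≤ 1 := by
  have := (Complex.le_def.mp (h.1.diag_nonneg (i := j))).1
  simp only [Matrix.sub_apply, one_apply_eq, mul_apply, conjTranspose_apply, Complex.sub_re,
    Complex.one_re, Complex.re_sum, Complex.zero_re, RCLike.star_def, Complex.conj_mul'] at this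
  norm_cast at this
  linarith

lemma IsContr.row_le {C : Matrix n n ℂ} (h : IsContr C) (i : n) : ∑ j, ‖C i j‖ ^ 2 ≤ 1 := by
  simpa using h.conjTranspose.col_le i

/-- Hölder's inequality against a doubly substochastic weight. -/
lemma sum_rpow_mul_rpow_le {ι : Type*} [Fintype ι] {x y : ι → ℝ} {D : ι → ι → ℝ}
    (hx : ∀ i, 0 ≤ x i) (hy : ∀ i, 0 ≤ y i)
    (hD : ∀ i j, 0 ≤ D i j) (hr : ∀ i, ∑ j, D i j ≤ 1) (hc : ∀ j, ∑ i, D i j ≤ 1)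
    {s t : ℝ} (hs : 0 ≤ s) (ht : 0 ≤ t) (hst : s + t = 1)
    (hX : 0 < ∑ i, x i) (hY : 0 < ∑ i, y i) :
    ∑ i, ∑ j, x i ^ s * y j ^ t * D i j ≤ (∑ i, x i) ^ s * (∑ i, y i) ^ t := by
  set X := ∑ i, x i
  set Y := ∑ i, y i
  have key (i j) : x i ^ s * y j ^ t * D i j ≤
      X ^ s * Y ^ t * (s * (x i / X * D i j) + t * (y j / Y * D i j)) := by
    have h1 := Real.geom_mean_le_arith_mean2_weighted hs ht (div_nonneg (hx i) hX.le)
      (div_nonneg (hy j) hY.le) hst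
    rw [Real.div_rpow (hx i) hX.le, Real.div_rpow (hy j) hY.le] at h1
    have hXs : 0 < X ^ s := by positivity
    have hYt : 0 < Y ^ t := by positivity
    have h2 : x i ^ s * y j ^ t ≤ X ^ s * Y ^ t * (s * (x i / X) + t * (y j / Y)) := by
      calc x i ^ s * y j ^ t = X ^ s * Y ^ t * (x i ^ s / X ^ s * (y j ^ t / Y ^ t)) := by
            field_simp
        _ ≤ _ := by gcongr
    calc _ ≤ X ^ s * Y ^ t * (s * (x i / X) + t * (y j / Y)) * D i j := by
          gcongr; exact hD i j
      _ = _ := by ring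
  have hA : ∑ i, ∑ j, x i / X * D i j ≤ 1 := by
    calc _ ≤ ∑ i, x i / X := by
          gcongr with i
          rw [← Finset.mul_sum]
          exact mul_le_of_le_one_right (div_nonneg (hx i) hX.le) (hr i)
      _ = 1 := by rw [← Finset.sum_div, div_self hX.ne']
  have hB : ∑ i, ∑ j, y j / Y * D i j ≤ 1 := by
    rw [Finset.sum_comm]
    calc _ ≤ ∑ j, y j / Y := by
          gcongr with j
          rw [← Finset.mul_sum]
          exact mul_le_of_le_one_right (div_nonneg (hy j) hY.le) (hc j)
      _ = 1 := by rw [← Finset.sum_div, div_self hY.ne']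
  calc _ ≤ ∑ i, ∑ j, X ^ s * Y ^ t * (s * (x i / X * D i j) + t * (y j / Y * D i j)) := by
        exact Finset.sum_le_sum fun i _ => Finset.sum_le_sum fun j _ => key i j
    _ = X ^ s * Y ^ t * (s * ∑ i, ∑ j, x i / X * D i j + t * ∑ i, ∑ j, y j / Y * D i j) := by
        simp only [← Finset.mul_sum, Finset.sum_add_distrib]
    _ ≤ X ^ s * Y ^ t * (s * 1 + t * 1) := by gcongr
    _ = _ := by rw [mul_one, mul_one, hst, mul_one]

lemma trace_conj_diagonal {V : Matrix n n ℂ} (hV : star V * V = 1) (g : n → ℂ) :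
    (V * diagonal g * star V).trace = ∑ i, g i := by
  rw [trace_mul_comm, ← mul_assoc, hV, one_mul, trace_diagonal]

/-- Hölder's inequality for Schatten norms, with `W = Y Yᴴ` and `Q = F Fᴴ`. -/
lemma norm_trace_le {Y F : Matrix n n ℂ} {l : ℂ} {α p s t : ℝ} (hs : 0 ≤ s) (ht : 0 ≤ t)
    (hst : s + t = 1) (hl : l.re = α * s - 1 / 2) (hpt : p * t = 1 / 2) :
    ‖(Yᴴ * matCPow (Y * Yᴴ) l * F).trace‖ ≤
      (matPow (Y * Yᴴ) α).trace.re ^ s * (matPow (F * Fᴴ) p).trace.re ^ t := by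
  have hW := posSemidef_self_mul_conjTranspose Y
  have hQ := posSemidef_self_mul_conjTranspose F
  have hnn : 0 ≤ (matPow (Y * Yᴴ) α).trace.re ^ s * (matPow (F * Fᴴ) p).trace.re ^ t :=
    mul_nonneg (Real.rpow_nonneg (trace_matPow_nonneg hW _) _)
      (Real.rpow_nonneg (trace_matPow_nonneg hQ _) _)
  by_cases hY0 : Y = 0
  · rw [hY0] at hnn ⊢
    simpa using hnn
  by_cases hF0 : F = 0
  · rw [hF0] at hnn ⊢
    simpa using hnn
  have hX := trace_matPow_pos hW (by simpa using hY0) α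
  have hZ := trace_matPow_pos hQ (by simpa using hF0) p
  set W := Y * Yᴴ with hWdef
  set Q := F * Fᴴ with hQdef
  clear hnn
  set C := matCPow W (-1 / 2 - l.im * Complex.I) * Y with hC
  have hCc : IsContr C := isContr_polar hWdef.symm (by simp)
  set D := matCPow Q (-1 / 2) * F with hD
  have hDc : IsContr D := isContr_polar hQdef.symm (by norm_num)
  have hF : F = matCPow Q ((1 / 2 : ℝ) : ℂ) * D := by
    rw [hD, ← mul_assoc, ← matCPow_add hQ]
    norm_num
    exact (matCPow_zero_mul_of_eq hQdef.symm).symm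
  have hYW : Yᴴ * matCPow W l = Cᴴ * matCPow W ((α * s : ℝ) : ℂ) := by
    rw [hC, conjTranspose_mul, matCPow_conjTranspose hW, mul_assoc, ← matCPow_add hW]
    congr 2
    apply Complex.ext
    · simp [hl]; norm_num; ring
    · simp
  obtain ⟨V, w, hV, hV', hw, -, -, hV3⟩ := exists_diag hW
  obtain ⟨G, q, hG, hG', hq, -, -, hG3⟩ := exists_diag hQ
  set M := star V * G with hM
  set N := star G * (D * Cᴴ) * V with hN
  have hMc : IsContr M := (isContr_of_unitary hV).conjTranspose.mul (isContr_of_unitary hG)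
  have hNc : IsContr N := ((isContr_of_unitary hG).conjTranspose.mul
    (hDc.mul hCc.conjTranspose)).mul (isContr_of_unitary hV)
  have htr : (Yᴴ * matCPow W l * F).trace =
      ∑ i, ∑ j, (supPow (w i) (α * s) : ℂ) * M i j * (supPow (q j) (1 / 2) : ℂ) * N j i := by
    rw [hYW, hF, ← matPow_eq_matCPow hW, ← matPow_eq_matCPow hQ, hV3, hG3]
    have : (Cᴴ * (V * diagonal (fun i => (supPow (w i) (α * s) : ℂ)) * star V) *
        (G * diagonal (fun i => (supPow (q i) (1 / 2) : ℂ)) * star G * D)).trace =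
        ((diagonal (fun i => (supPow (w i) (α * s) : ℂ)) * M) *
          (diagonal (fun i => (supPow (q i) (1 / 2) : ℂ)) * N)).trace := by
      rw [hM, hN]
      simp only [mul_assoc]
      rw [trace_mul_comm]
      simp only [mul_assoc]
      rw [trace_mul_comm V]
      simp only [mul_assoc]
    have tr (P R : Matrix n n ℂ) : (P * R).trace = ∑ i, ∑ j, P i j * R j i := by
      simp only [trace, diag_apply, mul_apply]
    rw [this, tr]
    simp only [diagonal_mul, mul_assoc]
  rw [htr]
  have hwsum : (matPow W α).trace.re = ∑ i, supPow (w i) α := by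
    rw [hV3, trace_conj_diagonal hV]; simp
  have hqsum : (matPow Q p).trace.re = ∑ i, supPow (q i) p := by
    rw [hG3, trace_conj_diagonal hG]; simp
  rw [hwsum] at hX ⊢
  rw [hqsum] at hZ ⊢
  have key := sum_rpow_mul_rpow_le (x := fun i => supPow (w i) α) (y := fun j => supPow (q j) p)
    (D := fun i j => (‖M i j‖ ^ 2 + ‖N j i‖ ^ 2) / 2) (fun i => supPow_nonneg (hw i) _)
    (fun i => supPow_nonneg (hq i) _) (fun i j => by positivity)
    (fun i => by
      rw [← Finset.sum_div, Finset.sum_add_distrib]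
      linarith [hMc.row_le i, hNc.col_le i])
    (fun j => by
      rw [← Finset.sum_div, Finset.sum_add_distrib]
      linarith [hMc.col_le j, hNc.row_le j]) hs ht hst hX hZ
  refine le_trans ?_ key
  refine (norm_sum_le _ _).trans (Finset.sum_le_sum fun i _ => ?_)
  refine (norm_sum_le _ _).trans (Finset.sum_le_sum fun j _ => ?_)
  rw [norm_mul, norm_mul, norm_mul, Complex.norm_real, Complex.norm_real,
    Real.norm_of_nonneg (supPow_nonneg (hw i) _), Real.norm_of_nonneg (supPow_nonneg (hq j) _)]
  have h1 := supPow_mul_le (hw i) α s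
  have h2 := supPow_mul_le (hq j) p t
  rw [hpt] at h2
  have h3 : ‖M i j‖ * ‖N j i‖ ≤ (‖M i j‖ ^ 2 + ‖N j i‖ ^ 2) / 2 := by
    nlinarith [sq_nonneg (‖M i j‖ - ‖N j i‖)]
  calc _ = supPow (w i) (α * s) * supPow (q j) (1 / 2) * (‖M i j‖ * ‖N j i‖) := by ring
    _ ≤ _ := by
      have := supPow_nonneg (hq j) (1 / 2)
      have := supPow_nonneg (hw i) α
      have := supPow_nonneg (hq j) p
      have : 0 ≤ supPow (w i) α ^ s * supPow (q j) p ^ t := by positivity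
      gcongr

end Holder

section Interpolation

variable {n m : Type*} [Fintype n] [DecidableEq n] [Fintype m] [DecidableEq m]

/-- Entire functions which are bounded on the strip `0 ≤ re z ≤ 1`. -/
def StripBounded (f : ℂ → ℂ) : Prop :=
  Differentiable ℂ f ∧ ∃ C : ℝ, ∀ z : ℂ, 0 ≤ z.re → z.re ≤ 1 → ‖f z‖ ≤ C

lemma stripBounded_const (c : ℂ) : StripBounded fun _ => c :=
  ⟨differentiable_const _, ‖c‖, fun _ _ _ => le_rfl⟩

lemma StripBounded.mul {f g : ℂ → ℂ} (hf : StripBounded f) (hg : StripBounded g) :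
    StripBounded fun z => f z * g z := by
  obtain ⟨hf, C, hC⟩ := hf
  obtain ⟨hg, D, hD⟩ := hg
  refine ⟨hf.mul hg, C * D, fun z h0 h1 => ?_⟩
  rw [norm_mul]
  exact mul_le_mul (hC z h0 h1) (hD z h0 h1) (norm_nonneg _) ((norm_nonneg _).trans (hC z h0 h1))

lemma StripBounded.sum {ι : Type*} {f : ι → ℂ → ℂ} (s : Finset ι)
    (hf : ∀ i, StripBounded (f i)) : StripBounded fun z => ∑ i ∈ s, f i z := by
  choose hd C hC using hf
  refine ⟨Differentiable.fun_sum fun i _ => hd i, ∑ i ∈ s, C i, fun z h0 h1 => ?_⟩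
  exact (norm_sum_le _ _).trans (Finset.sum_le_sum fun i _ => hC i z h0 h1)

lemma stripBounded_supCPow {x : ℝ} (hx : 0 ≤ x) (a b : ℝ) :
    StripBounded fun z => supCPow x (a + b * z) := by
  rcases hx.eq_or_lt with rfl | h
  · simpa [supCPow] using stripBounded_const 0
  · simp only [supCPow, h.ne', if_false]
    refine ⟨fun z => ?_, Real.exp (|Real.log x| * (|a| + |b|)), fun z h0 h1 => ?_⟩
    · exact DifferentiableAt.const_cpow (by fun_prop) (Or.inl (by exact_mod_cast h.ne'))
    · rw [Complex.norm_cpow_eq_rpow_re_of_pos h, Real.rpow_def_of_pos h]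
      apply Real.exp_le_exp.mpr
      refine (le_abs_self _).trans ?_
      rw [abs_mul]
      gcongr
      simp only [Complex.add_re, Complex.ofReal_re, Complex.mul_re, Complex.ofReal_im, zero_mul,
        sub_zero]
      refine (abs_add_le _ _).trans ?_
      rw [abs_mul, abs_of_nonneg h0]
      exact add_le_add_right (mul_le_of_le_one_right (abs_nonneg _) h1) _

lemma stripBounded_mul {ι : Type*} [Fintype ι] {F G : ℂ → Matrix ι ι ℂ}
    (hF : ∀ i j, StripBounded fun z => F z i j)
    (hG : ∀ i j, StripBounded fun z => G z i j) (i j : ι) :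
    StripBounded fun z => (F z * G z) i j := by
  simp only [mul_apply]
  exact StripBounded.sum _ fun k => (hF i k).mul (hG k j)

lemma stripBounded_matCPow {M : Matrix n n ℂ} (hM : M.PosSemidef) (a b : ℝ) (i j : n) :
    StripBounded fun z => matCPow M (a + b * z) i j := by
  obtain ⟨V, d, hV, hV', hd, h1, h2, h3⟩ := exists_diag hM
  simp only [h2]
  refine stripBounded_mul (F := fun z => V * diagonal fun i => supCPow (d i) (a + b * z))
    (G := fun _ => star V) (fun i j => ?_) (fun i j => stripBounded_const _) i j
  simp only [mul_diagonal]
  exact (stripBounded_const _).mul (stripBounded_supCPow (hd _) a b)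

lemma StripBounded.three_lines {f : ℂ → ℂ} (hf : StripBounded f) {a b x : ℝ} (hx0 : 0 ≤ x)
    (hx1 : x ≤ 1) (ha : ∀ z : ℂ, z.re = 0 → ‖f z‖ ≤ a) (hb : ∀ z : ℂ, z.re = 1 → ‖f z‖ ≤ b) :
    ‖f x‖ ≤ a ^ (1 - x) * b ^ x := by
  obtain ⟨hd, C, hC⟩ := hf
  have := Complex.HadamardThreeLines.norm_le_interp_of_mem_verticalClosedStrip₀₁' f
    (z := (x : ℂ)) (a := a) (b := b) (by simpa [Complex.HadamardThreeLines.verticalClosedStrip]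
      using ⟨hx0, hx1⟩) hd.diffContOnCl
    ⟨C, by rintro _ ⟨z, hz, rfl⟩; exact hC z hz.1 hz.2⟩ (fun z hz => ha z hz) (fun z hz => hb z hz)
  simpa using this

lemma trace_matPow_unitary_mul {F T : Matrix n n ℂ} (hT : star T * T = 1) (r : ℝ) :
    (matPow ((T * F) * (T * F)ᴴ) r).trace = (matPow (F * Fᴴ) r).trace := by
  rw [matPow_eq_matCPow (posSemidef_self_mul_conjTranspose _),
    matPow_eq_matCPow (posSemidef_self_mul_conjTranspose _)]
  have : (T * F) * (T * F)ᴴ = T * (F * Fᴴ) * star T := by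
    rw [conjTranspose_mul, star_eq_conjTranspose]; simp only [mul_assoc]
  rw [this, matCPow_unitary_conj (posSemidef_self_mul_conjTranspose _) hT, trace_mul_comm,
    ← mul_assoc, hT, one_mul]

/-- Complex interpolation of Schatten norms between the Hilbert-Schmidt norm and the
`2γ`-norm, stated through the moduli `F Fᴴ`. -/
lemma schatten_interpolation {F : ℂ → Matrix n n ℂ} (hF : ∀ i j, StripBounded fun z => F z i j)
    {x α γ : ℝ} (hx0 : 0 ≤ x) (hx1 : x ≤ 1) (hα : 0 < α) (hγ : 1 / 2 ≤ γ)
    (hrel : 1 / α = (1 - x) + x / γ)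
    (h0 : ∀ z : ℂ, z.re = 0 → ∃ T, star T * T = 1 ∧ F z = T * F 0)
    (h1 : ∀ z : ℂ, z.re = 1 → ∃ T, star T * T = 1 ∧ F z = T * F 1) :
    (matPow (F x * (F x)ᴴ) α).trace.re ^ (1 / α) ≤
      (F 0 * (F 0)ᴴ).trace.re ^ (1 - x) * (matPow (F 1 * (F 1)ᴴ) γ).trace.re ^ (x / γ) := by
  have hγ0 : 0 < γ := by linarith
  set Y := F x with hY
  have hW := posSemidef_self_mul_conjTranspose Y
  set K := (matPow (Y * Yᴴ) α).trace.re with hK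
  set m₀ := (F 0 * (F 0)ᴴ).trace.re with hm0
  set m₁ := (matPow (F 1 * (F 1)ᴴ) γ).trace.re with hm1
  have hm0' : (matPow (F 0 * (F 0)ᴴ) 1).trace.re = m₀ := by
    rw [matPow_eq_matCPow (posSemidef_self_mul_conjTranspose _), Complex.ofReal_one,
      matCPow_one (posSemidef_self_mul_conjTranspose _)]
  have hm0n : 0 ≤ m₀ := hm0' ▸ trace_matPow_nonneg (posSemidef_self_mul_conjTranspose _) _
  have hm1n : 0 ≤ m₁ := trace_matPow_nonneg (posSemidef_self_mul_conjTranspose _) _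
  have hKn : 0 ≤ K := trace_matPow_nonneg hW _
  rcases hKn.eq_or_lt with hK0 | hK0
  · rw [← hK0, Real.zero_rpow (by positivity)]
    positivity
  set a : ℝ := (α - 1) / 2 with ha
  set b : ℝ := α * (1 - 1 / (2 * γ)) - 1 / 2 - a with hb
  have hf : StripBounded fun z => (Yᴴ * matCPow (Y * Yᴴ) (a + b * z) * F z).trace := by
    refine StripBounded.sum _ fun i => ?_
    exact stripBounded_mul (F := fun z => Yᴴ * matCPow (Y * Yᴴ) (a + b * z))
      (fun i j => stripBounded_mul (F := fun _ => Yᴴ) (fun _ _ => stripBounded_const _)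
        (stripBounded_matCPow hW a b) i j) hF i i
  have hs : 0 ≤ 1 - 1 / (2 * γ) := by
    rw [sub_nonneg, div_le_one (by positivity)]; linarith
  have main := hf.three_lines hx0 hx1 (a := K ^ (1 / 2 : ℝ) * m₀ ^ (1 / 2 : ℝ))
    (b := K ^ (1 - 1 / (2 * γ)) * m₁ ^ (1 / (2 * γ))) (fun z hz => ?_) (fun z hz => ?_)
  rotate_left
  · obtain ⟨T, hT, hTF⟩ := h0 z hz
    have := norm_trace_le (Y := Y) (F := F z) (l := a + b * z) (α := α) (p := 1) (s := 1 / 2)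
      (t := 1 / 2) (by norm_num) (by norm_num) (by norm_num)
      (by simp [hz, ha]; ring) (by norm_num)
    rwa [hTF, trace_matPow_unitary_mul hT, hm0', ← hTF] at this
  · obtain ⟨T, hT, hTF⟩ := h1 z hz
    have := norm_trace_le (Y := Y) (F := F z) (l := a + b * z) (α := α) (p := γ)
      (s := 1 - 1 / (2 * γ)) (t := 1 / (2 * γ)) hs (by positivity) (by ring)
      (by simp [hz, hb]) (by field_simp)
    rwa [hTF, trace_matPow_unitary_mul hT, ← hTF] at this
  have hfx : (Yᴴ * matCPow (Y * Yᴴ) (a + b * (x : ℂ)) * F x).trace = (matPow (Y * Yᴴ) α).trace := by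
    rw [← hY, mul_assoc, trace_mul_comm, mul_assoc, matPow_eq_matCPow hW]
    have : matCPow (Y * Yᴴ) (a + b * (x : ℂ)) * (Y * Yᴴ) =
        matCPow (Y * Yᴴ) (a + b * (x : ℂ)) * matCPow (Y * Yᴴ) 1 := by rw [matCPow_one hW]
    rw [this, ← matCPow_add hW]
    have e : a + b * x + 1 = α := by
      have e1 : α * ((1 - x) + x / γ) = 1 := by rw [← hrel]; field_simp
      have e2 : 1 / (2 * γ) = (1 / γ) / 2 := by field_simp
      rw [hb, ha, e2]
      linear_combination (-1 / 2) * e1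
    congr 2
    exact_mod_cast e
  simp only [hfx] at main
  have hKle : K ≤ (K ^ (1 / 2 : ℝ) * m₀ ^ (1 / 2 : ℝ)) ^ (1 - x) *
      (K ^ (1 - 1 / (2 * γ)) * m₁ ^ (1 / (2 * γ))) ^ x :=
    ((le_abs_self K).trans (Complex.abs_re_le_norm _)).trans main
  rw [Real.mul_rpow (by positivity) (by positivity), Real.mul_rpow (by positivity) (by positivity),
    ← Real.rpow_mul hKn, ← Real.rpow_mul hKn, ← Real.rpow_mul hm0n, ← Real.rpow_mul hm1n] at hKle
  have hexp : 1 / 2 * (1 - x) + (1 - 1 / (2 * γ)) * x = 1 - 1 / (2 * α) := by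
    have : 1 / (2 * α) = (1 / α) / 2 := by field_simp
    rw [this, hrel]
    field_simp
    ring
  have hKle2 : K ≤ K ^ (1 - 1 / (2 * α)) *
      (m₀ ^ (1 / 2 * (1 - x)) * m₁ ^ (1 / (2 * γ) * x)) := by
    rw [← hexp, Real.rpow_add hK0]
    refine hKle.trans (le_of_eq (by ring))
  have hKle3 : K ^ (1 / (2 * α)) ≤ m₀ ^ (1 / 2 * (1 - x)) * m₁ ^ (1 / (2 * γ) * x) := by
    have hp : 0 < K ^ (1 - 1 / (2 * α)) := Real.rpow_pos_of_pos hK0 _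
    refine le_of_mul_le_mul_left ?_ hp
    rw [← Real.rpow_add hK0]
    simpa using hKle2
  have := Real.rpow_le_rpow (by positivity) hKle3 (by norm_num : (0 : ℝ) ≤ 2)
  rw [Real.mul_rpow (by positivity) (by positivity), ← Real.rpow_mul hKn, ← Real.rpow_mul hm0n,
    ← Real.rpow_mul hm1n] at this
  convert this using 2
  · field_simp
  · congr 1; ring
  · congr 1; field_simp

end Interpolation

section Decomposition

lemma margSnd_posSemidef {A B : Type*} [Fintype A] {ρ : Matrix (A × B) (A × B) ℂ}
    (hρ : ρ.PosSemidef) :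
    (margSnd ρ).PosSemidef := by
  have : margSnd ρ = ∑ a, ρ.submatrix (fun b => (a, b)) (fun b => (a, b)) := by
    ext b b'
    simp [margSnd, Matrix.sum_apply]
  rw [this]
  exact posSemidef_sum _ fun a _ => hρ.submatrix _

lemma margFst_posSemidef {A B : Type*} [Fintype B] {ρ : Matrix (A × B) (A × B) ℂ}
    (hρ : ρ.PosSemidef) :
    (margFst ρ).PosSemidef := by
  have : margFst ρ = ∑ b, ρ.submatrix (fun a => (a, b)) (fun a => (a, b)) := by
    ext b b'
    simp [margFst, Matrix.sum_apply]
  rw [this]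
  exact posSemidef_sum _ fun a _ => hρ.submatrix _

lemma trace_mul_one_kronecker {A B : Type*} [Fintype A] [Fintype B] [DecidableEq A]
    (ρ : Matrix (A × B) (A × B) ℂ) (S : Matrix B B ℂ) :
    (ρ * ((1 : Matrix A A ℂ) ⊗ₖ S)).trace = (margSnd ρ * S).trace := by
  simp only [trace, diag_apply, mul_apply, Fintype.sum_prod_type, kroneckerMap_apply, margSnd,
    of_apply, one_apply, ite_mul, one_mul, zero_mul, mul_ite, mul_zero, Finset.sum_mul]
  rw [Finset.sum_comm]
  refine Finset.sum_congr rfl fun b _ => ?_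
  rw [Finset.sum_comm (s := (Finset.univ : Finset B))]
  refine Finset.sum_congr rfl fun a _ => ?_
  rw [Finset.sum_comm]
  simp

variable {n : Type*} [Fintype n] [DecidableEq n]
variable {A B : Type*} [Fintype A] [Fintype B] [DecidableEq A] [DecidableEq B]

lemma exists_sqrt {ρ : Matrix n n ℂ} (hρ : ρ.PosSemidef) :
    ∃ X : Matrix n n ℂ, Xᴴ = X ∧ X * X = ρ := by
  refine ⟨matCPow ρ ((1 / 2 : ℝ) : ℂ), matCPow_ofReal_isHermitian hρ _, ?_⟩
  rw [← matCPow_add hρ]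
  conv_rhs => rw [← matCPow_one hρ]
  norm_num

lemma trace_mul_nonneg {M N : Matrix n n ℂ} (hM : M.PosSemidef) (hN : N.PosSemidef) :
    0 ≤ (M * N).trace.re := by
  obtain ⟨X, hX, rfl⟩ := exists_sqrt hN
  rw [← mul_assoc, trace_mul_comm, ← mul_assoc]
  have := (hM.conjTranspose_mul_mul_same X).trace_nonneg
  rw [hX] at this
  exact (Complex.le_def.mp this).1

lemma trace_mul_eq_zero_iff {M N : Matrix n n ℂ} (hM : M.PosSemidef) (hN : N.PosSemidef) :
    (M * N).trace = 0 ↔ N * M = 0 := by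
  refine ⟨fun h => ?_, fun h => by rw [trace_mul_comm, h, trace_zero]⟩
  obtain ⟨X, hX, rfl⟩ := exists_sqrt hN
  obtain ⟨Y, hY, rfl⟩ := exists_sqrt hM
  have h1 : ((X * Y) * (X * Y)ᴴ).trace = 0 := by
    rw [conjTranspose_mul, hX, hY, ← h]
    calc _ = (X * (Y * Y * X)).trace := by simp only [mul_assoc]
      _ = _ := by rw [trace_mul_comm]; simp only [mul_assoc]
  have h2 : X * Y = 0 := trace_mul_conjTranspose_self_eq_zero_iff.mp h1
  calc X * X * (Y * Y) = X * (X * Y) * Y := by simp only [mul_assoc]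
    _ = 0 := by simp [h2]

/-- The trace defining a sandwiched divergence is positive for non-orthogonal arguments. -/
lemma trace_sandwich_pos {ρ σ : Matrix n n ℂ} (hρ : ρ.PosSemidef) (hσ : σ.PosSemidef)
    (h : (ρ * σ).trace ≠ 0) (r α : ℝ) :
    0 < (matPow (matPow σ r * ρ * matPow σ r) α).trace.re := by
  have hH := matCPow_ofReal_isHermitian hσ r
  rw [matPow_eq_matCPow hσ r]
  apply trace_matPow_pos
  · nth_rewrite 1 [← hH]
    exact hρ.conjTranspose_mul_mul_same _
  · intro h0
    apply h
    rw [trace_mul_eq_zero_iff hρ hσ]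
    obtain ⟨X, hX, rfl⟩ := exists_sqrt hρ
    have h1 : (matCPow σ r * X) * (matCPow σ r * X)ᴴ = 0 := by
      rw [conjTranspose_mul, hH, hX, ← h0]; simp only [mul_assoc]
    have h2 := self_mul_conjTranspose_eq_zero.mp h1
    calc σ * (X * X) = matCPow σ (1 - r + r) * (X * X) := by
          rw [sub_add_cancel, matCPow_one hσ]
      _ = matCPow σ (1 - r) * (matCPow σ r * X) * X := by
          rw [matCPow_add hσ]; simp only [mul_assoc]
      _ = 0 := by simp [h2]

/-- The interpolation inequality behind the decomposition rules. -/
lemma sandwich_interpolation {ρ : Matrix (A × B) (A × B) ℂ} {τ : Matrix A A ℂ} {σ : Matrix B B ℂ}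
    (hρ : ρ.PosSemidef) (hτ : τ.PosSemidef) (hσ : σ.PosSemidef)
    (hsupp : ((1 : Matrix A A ℂ) ⊗ₖ matCPow σ 0) * ρ = ρ) {α γ u v w : ℝ} (hα : 0 < α)
    (hγ : 1 / 2 ≤ γ) (hv : v ≠ 0) (hw : w ≠ 0) (hu : u ≠ 0) (huvw : u = v + w)
    (hwu : 0 ≤ w / u) (hvu : 0 ≤ v / u) (hα' : 1 / α = 1 - 1 / u) (hγ' : 1 / γ = 1 - 1 / w) :
    (matPow (matPow (τ ⊗ₖ (1 : Matrix B B ℂ)) (-(1 / (2 * u))) * ρ *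
        matPow (τ ⊗ₖ (1 : Matrix B B ℂ)) (-(1 / (2 * u)))) α).trace.re ^ (1 / α) ≤
      (margSnd ρ * matCPow σ ((1 / v : ℝ) : ℂ)).trace.re ^ (v / u) *
      (matPow (matPow (τ ⊗ₖ σ) (-(1 / (2 * w))) * ρ *
        matPow (τ ⊗ₖ σ) (-(1 / (2 * w)))) γ).trace.re ^ (w / u / γ) := by
  obtain ⟨X, hX, hXX⟩ := exists_sqrt hρ
  have hsum : v / u = 1 - w / u := by field_simp; linarith
  set a : ℝ := -(1 / (2 * w)) with ha
  set b₀ : ℝ := 1 / (2 * v) with hb₀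
  set b₁ : ℝ := a - b₀ with hb₁
  set F : ℂ → Matrix (A × B) (A × B) ℂ := fun z =>
    (matCPow τ ((0 : ℝ) + a * z) ⊗ₖ matCPow σ (b₀ + b₁ * z)) * X with hFdef
  have hF : ∀ i j, StripBounded fun z => F z i j := by
    refine stripBounded_mul (fun i j => ?_) (fun i j => stripBounded_const _)
    exact (stripBounded_matCPow hτ 0 a _ _).mul (stripBounded_matCPow hσ b₀ b₁ _ _)
  have hphase (z : ℂ) : ∃ T, star T * T = 1 ∧ F z = T * F z.re := by
    obtain ⟨T, hT, hT'⟩ := exists_unitary_matCPow hτ ((0 : ℝ) + a * z)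
    obtain ⟨T₂, hT₂, hT₂'⟩ := exists_unitary_matCPow hσ (b₀ + b₁ * z)
    refine ⟨T ⊗ₖ T₂, ?_, ?_⟩
    · rw [star_eq_conjTranspose] at hT hT₂ ⊢
      rw [conjTranspose_kronecker, ← mul_kronecker_mul, hT, hT₂, one_kronecker_one]
    · simp only [hFdef]
      rw [hT', hT₂', ← mul_assoc, ← mul_kronecker_mul]
      simp
  have hFF {c d : ℝ} {z : ℂ} (hc : ((0 : ℝ) : ℂ) + a * z = c) (hd : (b₀ : ℂ) + b₁ * z = d) :
      F z * (F z)ᴴ = (matCPow τ c ⊗ₖ matCPow σ d) * ρ * (matCPow τ c ⊗ₖ matCPow σ d) := by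
    simp only [hFdef]
    rw [hc, hd, conjTranspose_mul, conjTranspose_kronecker, matCPow_ofReal_isHermitian hτ,
      matCPow_ofReal_isHermitian hσ, hX, ← hXX]
    simp only [mul_assoc]
  have hres := schatten_interpolation hF (x := w / u) (α := α) (γ := γ) hwu (by linarith) hα hγ
    (by
      rw [hα', div_eq_mul_one_div (w / u) γ, hγ']
      field_simp; ring)
    (fun z hz => by simpa [hz] using hphase z) (fun z hz => by simpa [hz] using hphase z)
  have e1 : F 1 * (F 1)ᴴ = matPow (τ ⊗ₖ σ) a * ρ * matPow (τ ⊗ₖ σ) a := by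
    rw [matPow_eq_matCPow (hτ.kronecker hσ), matCPow_kronecker hτ hσ]
    exact hFF (by simp) (by simp [hb₁])
  have ex : F ((w / u : ℝ) : ℂ) * (F ((w / u : ℝ) : ℂ))ᴴ =
      matPow (τ ⊗ₖ (1 : Matrix B B ℂ)) (-(1 / (2 * u))) * ρ *
        matPow (τ ⊗ₖ (1 : Matrix B B ℂ)) (-(1 / (2 * u))) := by
    rw [matPow_eq_matCPow (hτ.kronecker PosSemidef.one), matCPow_kronecker hτ PosSemidef.one,
      matCPow_one_left, hFF (c := -(1 / (2 * u))) (d := 0)]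
    · have hP : ((1 : Matrix A A ℂ) ⊗ₖ matCPow σ 0)ᴴ = (1 : Matrix A A ℂ) ⊗ₖ matCPow σ 0 := by
        have := matCPow_ofReal_isHermitian hσ 0
        rw [Complex.ofReal_zero] at this
        rw [conjTranspose_kronecker, conjTranspose_one, this]
      have hsupp' : ρ * ((1 : Matrix A A ℂ) ⊗ₖ matCPow σ 0) = ρ := by
        have := congrArg conjTranspose hsupp
        rwa [conjTranspose_mul, hP, hρ.1] at this
      have s1 (S : Matrix A A ℂ) : S ⊗ₖ matCPow σ 0 =
          (S ⊗ₖ (1 : Matrix B B ℂ)) * ((1 : Matrix A A ℂ) ⊗ₖ matCPow σ 0) := by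
        rw [← mul_kronecker_mul]; simp
      have s2 (S : Matrix A A ℂ) : S ⊗ₖ matCPow σ 0 =
          ((1 : Matrix A A ℂ) ⊗ₖ matCPow σ 0) * (S ⊗ₖ (1 : Matrix B B ℂ)) := by
        rw [← mul_kronecker_mul]; simp
      rw [Complex.ofReal_zero]
      obtain ⟨S, hS⟩ : ∃ S, S = matCPow τ ((-(1 / (2 * u)) : ℝ) : ℂ) := ⟨_, rfl⟩
      rw [← hS]
      calc (S ⊗ₖ matCPow σ 0) * ρ * (S ⊗ₖ matCPow σ 0)
          = ((S ⊗ₖ 1) * (1 ⊗ₖ matCPow σ 0)) * ρ * ((1 ⊗ₖ matCPow σ 0) * (S ⊗ₖ 1)) := by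
            rw [← s1 S, ← s2 S]
        _ = (S ⊗ₖ 1) * ((1 ⊗ₖ matCPow σ 0) * ρ * (1 ⊗ₖ matCPow σ 0)) * (S ⊗ₖ 1) := by
            simp only [mul_assoc]
        _ = _ := by rw [hsupp, hsupp']
    · norm_cast
      rw [ha]; field_simp; ring
    · norm_cast
      rw [hb₁, ha, hb₀, huvw]
      have : v + w ≠ 0 := huvw ▸ hu
      field_simp; ring
  have e0 : (F 0 * (F 0)ᴴ).trace.re ≤ (margSnd ρ * matCPow σ ((1 / v : ℝ) : ℂ)).trace.re := by
    have h2 : F 0 * (F 0)ᴴ = (matCPow τ (0 : ℝ) ⊗ₖ matCPow σ b₀) * ρ *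
        (matCPow τ (0 : ℝ) ⊗ₖ matCPow σ b₀) := hFF (by simp) (by simp)
    rw [h2, mul_assoc, trace_mul_comm, mul_assoc, ← mul_kronecker_mul, ← matCPow_add hτ,
      ← matCPow_add hσ, ← trace_mul_one_kronecker, ← sub_nonneg, ← Complex.sub_re, ← trace_sub,
      ← mul_sub]
    have h3 : (b₀ : ℂ) + b₀ = (1 / v : ℝ) := by
      norm_cast; rw [hb₀]; field_simp; norm_num
    rw [h3]
    have h4 : (1 : Matrix A A ℂ) ⊗ₖ matCPow σ ((1 / v : ℝ) : ℂ) -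
        matCPow τ ((0 : ℝ) + (0 : ℝ)) ⊗ₖ matCPow σ ((1 / v : ℝ) : ℂ) =
        (1 - matCPow τ 0) ⊗ₖ matCPow σ ((1 / v : ℝ) : ℂ) := by
      ext i j
      simp [sub_mul]
    rw [h4]
    refine trace_mul_nonneg hρ (PosSemidef.kronecker ?_ (matCPow_posSemidef hσ _))
    apply posSemidef_one_sub_of_idempotent
    · simpa using matCPow_ofReal_isHermitian hτ 0
    · rw [← matCPow_add hτ, add_zero]
  have e0' : 0 ≤ (F 0 * (F 0)ᴴ).trace.re :=
    (Complex.le_def.mp (posSemidef_self_mul_conjTranspose (F 0)).trace_nonneg).1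
  have e1' : 0 ≤ (matPow (F 1 * (F 1)ᴴ) γ).trace.re :=
    trace_matPow_nonneg (posSemidef_self_mul_conjTranspose _) _
  rw [← ex, ← e1, hsum]
  refine hres.trans ?_
  gcongr
  linarith

/-- Logarithmic form of an interpolation inequality, rescaled by `u`. -/
lemma mul_logb_le_of_rpow_le {K m Q p q r u : ℝ} (hK : 0 < K) (hm : 0 ≤ m) (hQ : 0 < Q)
    (hq : q ≠ 0) (hu : 0 ≤ u) (h : K ^ p ≤ m ^ q * Q ^ r) :
    u * p * Real.logb 2 K ≤ u * q * Real.logb 2 m + u * r * Real.logb 2 Q := by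
  have hKp : 0 < K ^ p := Real.rpow_pos_of_pos hK p
  have hm' : 0 < m := by
    refine hm.lt_of_ne' fun h0 => ?_
    rw [h0, Real.zero_rpow hq, zero_mul] at h
    linarith
  have := Real.logb_le_logb_of_le (b := 2) one_lt_two hKp h
  rw [Real.logb_mul (by positivity) (by positivity), Real.logb_rpow_eq_mul_logb_of_pos hK,
    Real.logb_rpow_eq_mul_logb_of_pos hm', Real.logb_rpow_eq_mul_logb_of_pos hQ] at this
  linarith [mul_le_mul_of_nonneg_left this hu]

lemma trace_mul_matCPow_le {ω σ : Matrix n n ℂ} (hω : ω.PosSemidef) (hσ : IsDensity σ)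
    {β v : ℝ} (hβ : 0 < β) (hv : 0 < v) (h : 1 / β = 1 - 1 / v) :
    (ω * matCPow σ ((1 / v : ℝ) : ℂ)).trace.re ≤ (matPow ω β).trace.re ^ (1 / β) := by
  obtain ⟨Y, hY⟩ : ∃ Y, Y = matCPow ω ((1 / 2 : ℝ) : ℂ) := ⟨_, rfl⟩
  have hYY : Y * Yᴴ = ω := by
    rw [hY, matCPow_ofReal_isHermitian hω, ← matCPow_add hω]
    conv_rhs => rw [← matCPow_one hω]
    norm_num
  have hFF : matCPow σ ((1 / v : ℝ) : ℂ) * (matCPow σ ((1 / v : ℝ) : ℂ))ᴴ =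
      matCPow σ ((2 / v : ℝ) : ℂ) := by
    rw [matCPow_ofReal_isHermitian hσ.1, ← matCPow_add hσ.1]
    norm_cast
    ring_nf
  have key := norm_trace_le (Y := Y) (F := matCPow σ ((1 / v : ℝ) : ℂ)) (l := ((1 / 2 : ℝ) : ℂ))
    (α := β) (p := v / 2) (s := 1 / β) (t := 1 / v) (by positivity) (by positivity)
    (by rw [h]; ring) (by rw [Complex.ofReal_re]; field_simp; norm_num) (by field_simp)
  rw [hFF, hYY, matPow_eq_matCPow (matCPow_posSemidef hσ.1 _), matCPow_matCPow hσ.1] at key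
  have h1 : ((2 / v : ℝ) : ℂ) * ((v / 2 : ℝ) : ℂ) = 1 := by
    norm_cast; field_simp
  have h2 : Yᴴ * matCPow ω ((1 / 2 : ℝ) : ℂ) = ω := by
    conv_rhs => rw [← hYY]
    rw [hY, matCPow_ofReal_isHermitian hω]
  rw [h1, matCPow_one hσ.1, hσ.2, h2] at key
  simp only [Complex.one_re, Real.one_rpow, mul_one] at key
  exact ((le_abs_self _).trans (Complex.abs_re_le_norm _)).trans key

lemma one_kronecker_support_mul {ρ : Matrix (A × B) (A × B) ℂ} (hρ : ρ.PosSemidef) :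
    ((1 : Matrix A A ℂ) ⊗ₖ matCPow (margSnd ρ) 0) * ρ = ρ := by
  have hB := margSnd_posSemidef hρ
  have h0 : (matCPow (margSnd ρ) 0)ᴴ = matCPow (margSnd ρ) 0 := by
    simpa using matCPow_ofReal_isHermitian hB 0
  have hP : (1 - matCPow (margSnd ρ) 0).PosSemidef :=
    posSemidef_one_sub_of_idempotent h0 (by rw [← matCPow_add hB, add_zero])
  have h1 : margSnd ρ * (1 - matCPow (margSnd ρ) 0) = 0 := by
    have := matCPow_add hB 1 0
    rw [add_zero, matCPow_one hB] at this
    rw [mul_sub, mul_one, ← this, sub_self]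
  have h2 := (trace_mul_eq_zero_iff hρ ((PosSemidef.one (n := A)).kronecker hP)).mp (by
    rw [trace_mul_one_kronecker, h1, trace_zero])
  have h3 : (1 : Matrix A A ℂ) ⊗ₖ (1 - matCPow (margSnd ρ) 0) =
      1 - (1 : Matrix A A ℂ) ⊗ₖ matCPow (margSnd ρ) 0 := by
    rw [← one_kronecker_one]
    ext i j
    simp only [kroneckerMap_apply, Matrix.sub_apply, mul_sub]
  rw [h3, sub_mul, one_mul, sub_eq_zero] at h2
  exact h2.symm

/-- Decomposition rule for orders above one, before optimizing over the marginals. -/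
lemma renyiEntropy_add_renyiDiv_le {ρ : Matrix (A × B) (A × B) ℂ} {τ : Matrix A A ℂ}
    {σ : Matrix B B ℂ} (hρ : ρ.PosSemidef) (hτ : τ.PosSemidef) (hσ : IsDensity σ) {α β γ : ℝ}
    (hα : 1 < α) (hβ : 1 < β) (hγ : 1 < γ)
    (hrel : α / (α - 1) = β / (β - 1) + γ / (γ - 1)) :
    (renyiEntropy β (margSnd ρ) : EReal) + renyiDiv α ρ (τ ⊗ₖ (1 : Matrix B B ℂ)) ≤
      renyiDiv γ ρ (τ ⊗ₖ σ) := by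
  have hM := hτ.kronecker (PosSemidef.one (n := B) (R := ℂ))
  have hN := hτ.kronecker hσ.1
  by_cases hcond : (ρ * (τ ⊗ₖ σ)).trace ≠ 0 ∧ (Dominates (τ ⊗ₖ σ) ρ ∨ γ < 1)
  swap
  · rw [renyiDiv, renyiDiv, if_neg hcond]
    exact le_top
  obtain ⟨hne, hdom⟩ := hcond
  have hdom : Dominates (τ ⊗ₖ σ) ρ := hdom.resolve_right hγ.not_gt
  have hfac : τ ⊗ₖ σ = ((1 : Matrix A A ℂ) ⊗ₖ σ) * (τ ⊗ₖ (1 : Matrix B B ℂ)) := by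
    rw [← mul_kronecker_mul]; simp
  have hne' : (ρ * (τ ⊗ₖ (1 : Matrix B B ℂ))).trace ≠ 0 := by
    rw [Ne, trace_mul_eq_zero_iff hρ hM]
    rw [Ne, trace_mul_eq_zero_iff hρ hN, hfac, mul_assoc] at hne
    intro h
    exact hne (by rw [h, mul_zero])
  have hdom' : Dominates (τ ⊗ₖ (1 : Matrix B B ℂ)) ρ := by
    intro x hx
    apply hdom
    rw [hfac, ← mulVec_mulVec, hx, mulVec_zero]
  have hsupp : ((1 : Matrix A A ℂ) ⊗ₖ matCPow σ 0) * ρ = ρ := by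
    have h0 : (matCPow σ 0)ᴴ = matCPow σ 0 := by
      simpa using matCPow_ofReal_isHermitian hσ.1 0
    have hz : (τ ⊗ₖ σ) * (1 - (1 : Matrix A A ℂ) ⊗ₖ matCPow σ 0) = 0 := by
      have := matCPow_add hσ.1 1 0
      rw [add_zero, matCPow_one hσ.1] at this
      rw [mul_sub, mul_one, ← mul_kronecker_mul, mul_one, ← this, sub_self]
    have hz' : ρ * (1 - (1 : Matrix A A ℂ) ⊗ₖ matCPow σ 0) = 0 := by
      refine ext_of_mulVec_single fun i => ?_
      rw [← mulVec_mulVec, zero_mulVec]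
      apply hdom
      rw [mulVec_mulVec, hz, zero_mulVec]
    have := congrArg conjTranspose hz'
    rw [conjTranspose_mul, conjTranspose_sub, conjTranspose_kronecker, conjTranspose_one, h0, hρ.1,
      conjTranspose_one, conjTranspose_zero, sub_mul, one_mul, sub_eq_zero] at this
    exact this.symm
  rw [renyiDiv, renyiDiv, if_pos ⟨hne', Or.inl hdom'⟩, if_pos ⟨hne, Or.inl hdom⟩]
  have hα1 : 0 < α - 1 := by linarith
  have hβ1 : 0 < β - 1 := by linarith
  have hγ1 : 0 < γ - 1 := by linarith
  obtain ⟨u, hu⟩ : ∃ u, u = α / (α - 1) := ⟨_, rfl⟩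
  obtain ⟨v, hv⟩ : ∃ v, v = β / (β - 1) := ⟨_, rfl⟩
  obtain ⟨w, hw⟩ : ∃ w, w = γ / (γ - 1) := ⟨_, rfl⟩
  have hu0 : 0 < u := by rw [hu]; positivity
  have hv0 : 0 < v := by rw [hv]; positivity
  have hw0 : 0 < w := by rw [hw]; positivity
  have key := sandwich_interpolation (τ := τ) hρ hτ hσ.1 hsupp (α := α) (γ := γ) (u := u) (v := v)
    (w := w) (by linarith) (by linarith) hv0.ne' hw0.ne' hu0.ne' (by rw [hu, hv, hw, hrel])
    (by positivity) (by positivity) (by rw [hu]; field_simp; ring) (by rw [hw]; field_simp; ring)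
  have hm := trace_mul_matCPow_le (margSnd_posSemidef hρ) hσ (β := β) (v := v) (by linarith) hv0
    (by rw [hv]; field_simp; ring)
  have hm0 : 0 ≤ (margSnd ρ * matCPow σ ((1 / v : ℝ) : ℂ)).trace.re :=
    trace_mul_nonneg (margSnd_posSemidef hρ) (matCPow_posSemidef hσ.1 _)
  have eα : (1 - α) / (2 * α) = -(1 / (2 * u)) := by rw [hu]; field_simp; ring
  have eγ : (1 - γ) / (2 * γ) = -(1 / (2 * w)) := by rw [hw]; field_simp; ring
  have hK := trace_sandwich_pos hρ hM hne' ((1 - α) / (2 * α)) α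
  have hQ := trace_sandwich_pos hρ hN hne ((1 - γ) / (2 * γ)) γ
  have hZ := trace_matPow_nonneg (margSnd_posSemidef hρ) β
  rw [renyiEntropy]
  rw [← eα, ← eγ] at key
  have key2 := key.trans (mul_le_mul_of_nonneg_right
    (Real.rpow_le_rpow hm0 hm (div_nonneg hv0.le hu0.le)) (Real.rpow_nonneg hQ.le _))
  rw [← Real.rpow_mul hZ] at key2
  have hlog := mul_logb_le_of_rpow_le hK hZ hQ (by positivity) hu0.le key2
  rw [← EReal.coe_add, EReal.coe_le_coe_iff]
  have c1 : u * (1 / α) = (α - 1)⁻¹ := by rw [hu]; field_simp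
  have c2 : u * (1 / β * (v / u)) = (β - 1)⁻¹ := by
    rw [show u * (1 / β * (v / u)) = v * (1 / β) by field_simp, hv]; field_simp
  have c3 : u * (w / u / γ) = (γ - 1)⁻¹ := by
    rw [show u * (w / u / γ) = w * (1 / γ) by field_simp, hw]; field_simp
  have c4 : (1 - β)⁻¹ = -(β - 1)⁻¹ := by rw [← neg_sub, inv_neg]
  rw [c1, c2, c3] at hlog
  rw [c4]
  linarith

/-- Decomposition rule for orders below one, before optimizing over `σ_A`; the optimal `σ_B` is
proportional to `ρ_B ^ β`. -/
lemma exists_renyiDiv_le {ρ : Matrix (A × B) (A × B) ℂ} (hρ : IsDensity ρ) {α β γ : ℝ}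
    (hα0 : 0 < α) (hα : α < 1) (hβ0 : 0 < β) (hβ : β < 1) (hγ0 : 1 / 2 ≤ γ) (hγ : γ < 1)
    (hrel : α / (α - 1) = β / (β - 1) + γ / (γ - 1)) :
    ∃ σ : Matrix B B ℂ, IsDensity σ ∧ ∀ τ : Matrix A A ℂ, τ.PosSemidef →
      renyiDiv γ ρ (τ ⊗ₖ σ) ≤
        (renyiEntropy β (margSnd ρ) : EReal) + renyiDiv α ρ (τ ⊗ₖ (1 : Matrix B B ℂ)) := by
  have hB := margSnd_posSemidef hρ.1
  have hBtr : (margSnd ρ).trace = 1 := by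
    have := trace_mul_one_kronecker ρ (1 : Matrix B B ℂ)
    rwa [one_kronecker_one, mul_one, mul_one, hρ.2, eq_comm] at this
  have hB0 : margSnd ρ ≠ 0 := by
    intro h
    simp [h] at hBtr
  obtain ⟨Z, hZdef⟩ : ∃ Z, Z = (matPow (margSnd ρ) β).trace.re := ⟨_, rfl⟩
  have hZ : 0 < Z := hZdef ▸ trace_matPow_pos hB hB0 β
  have hZtr : (matCPow (margSnd ρ) β).trace = (Z : ℂ) := by
    have h1 := (matCPow_posSemidef hB β).trace_nonneg
    rw [hZdef, matPow_eq_matCPow hB]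
    apply Complex.ext
    · simp
    · simpa using (Complex.le_def.mp h1).2.symm
  have hpow := matCPow_posSemidef hB β
  have hσps : (((Z⁻¹ : ℝ) : ℂ) • matCPow (margSnd ρ) β).PosSemidef :=
    hpow.smul (by exact_mod_cast (inv_pos.mpr hZ).le)
  have hσ : IsDensity (((Z⁻¹ : ℝ) : ℂ) • matCPow (margSnd ρ) β) := by
    refine ⟨hσps, ?_⟩
    rw [trace_smul, hZtr, smul_eq_mul, ← Complex.ofReal_mul, inv_mul_cancel₀ hZ.ne',
      Complex.ofReal_one]
  have hσpow (r : ℝ) : matCPow (((Z⁻¹ : ℝ) : ℂ) • matCPow (margSnd ρ) β) r =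
      ((Z⁻¹ ^ r : ℝ) : ℂ) • matCPow (margSnd ρ) ((β * r : ℝ) : ℂ) := by
    rw [matCPow_smul hpow (inv_pos.mpr hZ), matCPow_matCPow hB,
      Complex.ofReal_cpow (inv_pos.mpr hZ).le, Complex.ofReal_mul]
  refine ⟨_, hσ, fun τ hτ => ?_⟩
  set σ := ((Z⁻¹ : ℝ) : ℂ) • matCPow (margSnd ρ) β with hσdef
  have hσ0 : matCPow σ 0 = matCPow (margSnd ρ) 0 := by simpa using hσpow 0
  have hsupp : ((1 : Matrix A A ℂ) ⊗ₖ matCPow σ 0) * ρ = ρ := by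
    rw [hσ0]; exact one_kronecker_support_mul hρ.1
  have hM := hτ.kronecker (PosSemidef.one (n := B) (R := ℂ))
  have hN := hτ.kronecker hσ.1
  by_cases hne' : (ρ * (τ ⊗ₖ (1 : Matrix B B ℂ))).trace = 0
  · have : renyiDiv α ρ (τ ⊗ₖ (1 : Matrix B B ℂ)) = ⊤ := by
      rw [renyiDiv, if_neg (fun h => h.1 hne')]
    rw [this, EReal.coe_add_top]
    exact le_top
  have hne : (ρ * (τ ⊗ₖ σ)).trace ≠ 0 := by
    rw [Ne, trace_mul_eq_zero_iff hρ.1 hN]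
    intro h
    apply hne'
    rw [trace_mul_eq_zero_iff hρ.1 hM]
    calc (τ ⊗ₖ (1 : Matrix B B ℂ)) * ρ
        = (τ ⊗ₖ (1 : Matrix B B ℂ)) * (((1 : Matrix A A ℂ) ⊗ₖ matCPow σ (-1 + 1)) * ρ) := by
          rw [neg_add_cancel, hsupp]
      _ = ((1 : Matrix A A ℂ) ⊗ₖ matCPow σ (-1)) * ((τ ⊗ₖ σ) * ρ) := by
          rw [matCPow_add hσ.1, matCPow_one hσ.1, ← mul_assoc, ← mul_assoc, ← mul_kronecker_mul,
            ← mul_kronecker_mul, one_mul, one_mul, mul_one]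
      _ = 0 := by rw [h, mul_zero]
  rw [renyiDiv, renyiDiv, if_pos ⟨hne, Or.inr hγ⟩, if_pos ⟨hne', Or.inr hα⟩]
  have hα1 : 0 < 1 - α := by linarith
  have hβ1 : 0 < 1 - β := by linarith
  have hγ1 : 0 < 1 - γ := by linarith
  have hγpos : 0 < γ := by linarith
  obtain ⟨u, hu⟩ : ∃ u, u = α / (1 - α) := ⟨_, rfl⟩
  obtain ⟨v, hv⟩ : ∃ v, v = β / (1 - β) := ⟨_, rfl⟩
  obtain ⟨w, hw⟩ : ∃ w, w = γ / (1 - γ) := ⟨_, rfl⟩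
  have hu0 : 0 < u := by rw [hu]; positivity
  have hv0 : 0 < v := by rw [hv]; positivity
  have hw0 : 0 < w := by rw [hw]; positivity
  have huvw : u = v + w := by
    rw [← neg_sub 1 α, ← neg_sub 1 β, ← neg_sub 1 γ, div_neg, div_neg, div_neg] at hrel
    rw [hu, hv, hw]; linarith
  have key := sandwich_interpolation (τ := τ) hρ.1 hτ hσ.1 hsupp (α := α) (γ := γ) (u := -u)
    (v := -v) (w := -w) hα0 hγ0 (neg_ne_zero.mpr hv0.ne') (neg_ne_zero.mpr hw0.ne')
    (neg_ne_zero.mpr hu0.ne') (by linarith) (by rw [neg_div_neg_eq]; positivity)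
    (by rw [neg_div_neg_eq]; positivity) (by rw [hu]; field_simp; ring)
    (by rw [hw]; field_simp; ring)
  have hm : (margSnd ρ * matCPow σ ((1 / -v : ℝ) : ℂ)).trace.re = Z ^ (1 / β) := by
    have h1 : margSnd ρ * matCPow (margSnd ρ) ((β * (1 / -v) : ℝ) : ℂ) =
        matCPow (margSnd ρ) β := by
      have := matCPow_add hB 1 ((β * (1 / -v) : ℝ) : ℂ)
      rw [matCPow_one hB] at this
      rw [← this]
      congr 1
      norm_cast
      rw [hv]; field_simp; ring
    rw [hσpow, mul_smul_comm, h1, trace_smul, hZtr, smul_eq_mul, ← Complex.ofReal_mul,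
      Complex.ofReal_re, Real.inv_rpow hZ.le, ← Real.rpow_neg hZ.le]
    nth_rewrite 2 [← Real.rpow_one Z]
    rw [← Real.rpow_add hZ]
    congr 1
    rw [hv]; field_simp; ring
  have eα : (1 - α) / (2 * α) = -(1 / (2 * -u)) := by rw [hu]; field_simp
  have eγ : (1 - γ) / (2 * γ) = -(1 / (2 * -w)) := by rw [hw]; field_simp
  have hK := trace_sandwich_pos hρ.1 hM hne' ((1 - α) / (2 * α)) α
  have hQ := trace_sandwich_pos hρ.1 hN hne ((1 - γ) / (2 * γ)) γ
  rw [renyiEntropy, ← hZdef]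
  rw [← eα, ← eγ, hm, neg_div_neg_eq, neg_div_neg_eq, ← Real.rpow_mul hZ.le] at key
  have hlog := mul_logb_le_of_rpow_le hK hZ.le hQ (by positivity) hu0.le key
  rw [← EReal.coe_add, EReal.coe_le_coe_iff]
  have c1 : u * (1 / α) = -(α - 1)⁻¹ := by rw [← inv_neg, neg_sub, hu]; field_simp
  have c2 : u * (1 / β * (v / u)) = (1 - β)⁻¹ := by
    rw [show u * (1 / β * (v / u)) = v * (1 / β) by field_simp, hv]; field_simp
  have c3 : u * (w / u / γ) = -(γ - 1)⁻¹ := by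
    rw [show u * (w / u / γ) = w * (1 / γ) by field_simp, hw, ← inv_neg, neg_sub]; field_simp
  rw [c1, c2, c3] at hlog
  linarith

end Decomposition

/-- **Proposition 1:** for `1/α' = 1/β' + 1/γ'`: if `α ∈ (1,2)` and `β, γ ∈ (1,∞)` then the
decomposition rules hold with `≥`; if `α ∈ [2/3,1)` and `β, γ ∈ [1/2,1)` they hold with `≤`. -/
theorem renyi_decomposition_prop1
    {A B : Type*} [Fintype A] [Fintype B] [DecidableEq A] [DecidableEq B]
    (ρ : Matrix (A × B) (A × B) ℂ) (hρ : IsDensity ρ)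
    {α β γ : ℝ} (hα1 : α ≠ 1) (hβ1 : β ≠ 1) (hγ1 : γ ≠ 1)
    (hrel : α / (α - 1) = β / (β - 1) + γ / (γ - 1)) :
    ((1 < α ∧ α < 2) → (1 < β) → (1 < γ) →
      (mutInfUp γ ρ ≥ (renyiEntropy β (margSnd ρ) : EReal) - condEntDown α ρ ∧
        mutInfDown γ ρ ≥ (renyiEntropy β (margSnd ρ) : EReal) - condEntUp α ρ)) ∧
    ((2 / 3 ≤ α ∧ α < 1) → (1 / 2 ≤ β ∧ β < 1) → (1 / 2 ≤ γ ∧ γ < 1) →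
      (mutInfUp γ ρ ≤ (renyiEntropy β (margSnd ρ) : EReal) - condEntDown α ρ ∧
        mutInfDown γ ρ ≤ (renyiEntropy β (margSnd ρ) : EReal) - condEntUp α ρ)) := by
  have hsub (x y : EReal) : x - -y = x + y := by rw [sub_eq_add_neg, neg_neg]
  refine ⟨fun hα hβ hγ => ⟨?_, ?_⟩, fun hα hβ hγ => ?_⟩
  · rw [condEntDown, hsub]
    exact le_iInf fun σ => renyiEntropy_add_renyiDiv_le hρ.1 (margFst_posSemidef hρ.1) σ.2 hα.1 hβ
      hγ hrel
  · refine le_iInf fun τ => le_iInf fun σ => ?_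
    refine le_trans ?_ (renyiEntropy_add_renyiDiv_le hρ.1 τ.2.1 σ.2 hα.1 hβ hγ hrel)
    have hle : -renyiDiv α ρ ((τ : Matrix A A ℂ) ⊗ₖ (1 : Matrix B B ℂ)) ≤ condEntUp α ρ := by
      rw [condEntUp]
      exact le_iSup (fun σA : {σ : Matrix A A ℂ // IsDensity σ} =>
        -renyiDiv α ρ ((σA : Matrix A A ℂ) ⊗ₖ (1 : Matrix B B ℂ))) τ
    rw [sub_eq_add_neg]
    exact add_le_add_right (EReal.neg_le.mp hle) _
  · obtain ⟨σ, hσ, h⟩ := exists_renyiDiv_le hρ (by linarith) hα.2 (by linarith) hβ.2 hγ.1 hγ.2 hrel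
    refine ⟨?_, ?_⟩
    · rw [condEntDown, hsub, mutInfUp]
      exact iInf_le_of_le ⟨σ, hσ⟩ (h _ (margFst_posSemidef hρ.1))
    · have hle (τ : {τ : Matrix A A ℂ // IsDensity τ}) : mutInfDown γ ρ ≤
          (renyiEntropy β (margSnd ρ) : EReal) +
            renyiDiv α ρ ((τ : Matrix A A ℂ) ⊗ₖ (1 : Matrix B B ℂ)) := by
        rw [mutInfDown]
        exact iInf_le_of_le τ (iInf_le_of_le ⟨σ, hσ⟩ (h _ τ.2.1))
      rw [sub_eq_add_neg, add_comm, ← EReal.sub_le_iff_le_add (Or.inl (EReal.coe_ne_bot _))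
        (Or.inl (EReal.coe_ne_top _))]
      rw [EReal.le_neg, condEntUp]
      refine iSup_le fun τ => ?_
      rw [EReal.neg_le_neg_iff, EReal.sub_le_iff_le_add (Or.inl (EReal.coe_ne_bot _))
        (Or.inl (EReal.coe_ne_top _)), add_comm]
      exact hle τ
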